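/- arXiv:1803.11433 — 5 statements merged into one kernel-verified Lean document; each statement's English description precedes it below -/
import Mathlib

section
/- There exists a monic polynomial G of degree n with real coefficients, depending only on a_1,…,a_n and b_1,…,b_n (not on w), such that for every w ∈ ℂ ∖ {0} and every x ∈ ℂ, det(x·I_n − L(w)) = G(x) − (w + w^{-1})·B. -/
open Matrix Polynomial

noncomputable section

/-- The periodic Jacobi matrix `L(w)` with real entries `aᵢ` on the diagonal,
`bᵢ` on the sub/superdiagonal, and corner entries `w·bₙ` and `w⁻¹·bₙ`. -/
def Lw (n : ℕ) (a b : Fin n → ℝ) (w : ℂ) : Matrix (Fin n) (Fin n) ℂ :=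
  fun i j =>
    if (i : ℕ) = (j : ℕ) then (a i : ℂ)
    else if (j : ℕ) = (i : ℕ) + 1 then (b i : ℂ)
    else if (i : ℕ) = (j : ℕ) + 1 then (b j : ℂ)
    else if (i : ℕ) = n - 1 ∧ (j : ℕ) = 0 then w * (b i : ℂ)
    else if (i : ℕ) = 0 ∧ (j : ℕ) = n - 1 then w⁻¹ * (b j : ℂ)
    else 0

end

theorem det_add_single_aux {R : Type*} [CommRing R] {m : ℕ} (A : Matrix (Fin m) (Fin m) R)
    (i j : Fin m) (p : R) :
    (A + Matrix.single i j p).det = A.det + p * A.adjugate j i := by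
  have h : A + Matrix.single i j p = A.updateRow i (A i + p • Pi.single j 1) := by
    ext k l
    by_cases hk : k = i
    · subst hk
      by_cases hl : l = j
      · subst hl; simp
      · simp [Matrix.single_apply, Ne.symm hl, hl]
    · simp [Matrix.single_apply, hk, Ne.symm hk]
  rw [h, Matrix.det_updateRow_add, Matrix.det_updateRow_smul, Matrix.updateRow_eq_self,
    Matrix.adjugate_apply]

theorem det_two_corner_aux {R : Type*} [CommRing R] {m : ℕ} (A : Matrix (Fin m) (Fin m) R)
    (i j : Fin m) (hij : i ≠ j) :
    ∃ K : R, ∀ p q : R, (A + Matrix.single j i q + Matrix.single i j p).det =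
      A.det + q * A.adjugate i j + p * A.adjugate j i + p * q * K := by
  refine ⟨(A.updateRow i (Pi.single j 1)).adjugate i j, fun p q => ?_⟩
  have h : (A + Matrix.single j i q).updateRow i (Pi.single j 1) =
      A.updateRow i (Pi.single j 1) + Matrix.single j i q := by
    ext k l
    by_cases hk : k = i
    · subst hk
      simp [Matrix.single_apply, Ne.symm hij]
    · simp [hk]
  rw [det_add_single_aux, det_add_single_aux, Matrix.adjugate_apply _ j i, h,
    det_add_single_aux, Matrix.adjugate_apply A j i]
  ring

/-- The tridiagonal part of `x - L`. -/
def triAux (m : ℕ) (a b : Fin (m+1) → ℝ) (x : ℂ) : Matrix (Fin (m+1)) (Fin (m+1)) ℂ :=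
  fun i j =>
    if (i : ℕ) = (j : ℕ) then x - (a i : ℂ)
    else if (j : ℕ) = (i : ℕ) + 1 then -(b i : ℂ)
    else if (i : ℕ) = (j : ℕ) + 1 then -(b j : ℂ)
    else 0

theorem triAux_transpose (m : ℕ) (a b : Fin (m+1) → ℝ) (x : ℂ) :
    (triAux m a b x)ᵀ = triAux m a b x := by
  ext i j
  simp only [Matrix.transpose_apply, triAux]
  by_cases h : i = j
  · subst h; rfl
  · have : (i : ℕ) ≠ j := fun h' => h (Fin.ext h')
    split_ifs <;> first | rfl | omega

theorem triAux_adj (m : ℕ) (a b : Fin (m+1) → ℝ) (x : ℂ) :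
    (triAux m a b x).adjugate 0 (Fin.last m) = ∏ i : Fin m, (b i.castSucc : ℂ) := by
  rw [Matrix.adjugate_fin_succ_eq_det_submatrix, Matrix.det_of_lowerTriangular]
  · have : ∀ i : Fin m, (triAux m a b x).submatrix (Fin.last m).succAbove (Fin.succAbove 0) i i
        = -(b i.castSucc : ℂ) := by
      intro i
      simp [triAux]
    simp only [this, Finset.prod_neg, Finset.card_univ, Fintype.card_fin]
    rw [← mul_assoc, ← pow_add]
    simp [← two_mul]
  · intro i j hij
    have hij' : (i : ℕ) < j := by simpa using hij
    simp only [Matrix.submatrix_apply, triAux, Fin.succAbove_last, Fin.succAbove_zero,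
      Fin.val_castSucc, Fin.val_succ]
    split_ifs <;> first | rfl | omega

theorem Lw_decomp (m : ℕ) (hm : 2 ≤ m) (a b : Fin (m+1) → ℝ) (w x : ℂ) :
    x • (1 : Matrix (Fin (m+1)) (Fin (m+1)) ℂ) - Lw (m+1) a b w =
      triAux m a b x + Matrix.single 0 (Fin.last m) (-(w⁻¹ * b (Fin.last m)))
        + Matrix.single (Fin.last m) 0 (-(w * b (Fin.last m))) := by
  ext i j
  simp only [Matrix.sub_apply, Matrix.add_apply, Matrix.smul_apply, Matrix.one_apply, Lw, triAux,
    Matrix.single_apply, Fin.ext_iff, Fin.val_last, Fin.val_zero, Nat.add_sub_cancel, smul_eq_mul]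
  have e1 : (i : ℕ) = m → i = Fin.last m := fun h => Fin.ext h
  have e2 : (j : ℕ) = m → j = Fin.last m := fun h => Fin.ext h
  split_ifs <;> first
    | omega
    | (simp; done)
    | (rw [e1 (by omega)]; simp; done)
    | (rw [e2 (by omega)]; simp; done)

theorem det_diff (m : ℕ) (hm : 2 ≤ m) (a b : Fin (m+1) → ℝ) (w x : ℂ) (hw : w ≠ 0) :
    (x • (1 : Matrix (Fin (m+1)) (Fin (m+1)) ℂ) - Lw (m+1) a b w).det =
    (x • (1 : Matrix (Fin (m+1)) (Fin (m+1)) ℂ) - Lw (m+1) a b 1).det + 2 * ∏ i, (b i : ℂ)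
      - (w + w⁻¹) * ∏ i, (b i : ℂ) := by
  obtain ⟨K, hK⟩ := det_two_corner_aux (triAux m a b x) (Fin.last m) 0
    (by simp [Fin.ext_iff]; omega)
  have h2 : (triAux m a b x).adjugate (Fin.last m) 0 = ∏ i : Fin m, (b i.castSucc : ℂ) := by
    rw [← triAux_adj m a b x, ← Matrix.transpose_apply (triAux m a b x).adjugate,
      Matrix.adjugate_transpose, triAux_transpose]
  rw [Lw_decomp m hm, Lw_decomp m hm, hK, hK, h2, triAux_adj, Fin.prod_univ_castSucc]
  field_simp
  ring

/-- there is a monic real polynomial `G` of degree `n`, independent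
of `w`, with `det(x·I − L(w)) = G(x) − (w + w⁻¹)·B` for all `w ≠ 0` and all `x`. -/
theorem statement14 (n : ℕ) (hn : 3 ≤ n) (a b : Fin n → ℝ) (hb : ∀ i, 0 < b i) :
    ∃ G : Polynomial ℝ, G.Monic ∧ G.natDegree = n ∧
      ∀ w : ℂ, w ≠ 0 → ∀ x : ℂ,
        (x • (1 : Matrix (Fin n) (Fin n) ℂ) - Lw n a b w).det =
          (G.map (algebraMap ℝ ℂ)).eval x - (w + w⁻¹) * ∏ i, (b i : ℂ) := by
  obtain ⟨m, rfl⟩ : ∃ m, n = m + 1 := ⟨n - 1, by omega⟩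
  let M : Matrix (Fin (m+1)) (Fin (m+1)) ℝ := (Lw (m+1) a b 1).map Complex.re
  have hM : Lw (m+1) a b 1 = M.map (algebraMap ℝ ℂ) := by
    ext i j
    simp only [M, Matrix.map_apply, Lw]
    split_ifs <;> simp
  have hdeg : M.charpoly.natDegree = m + 1 := by simp [Matrix.charpoly_natDegree_eq_dim]
  have hlt : (C (2 * ∏ i, b i)).degree < M.charpoly.degree := by
    refine lt_of_le_of_lt degree_C_le ?_
    rw [← natDegree_pos_iff_degree_pos]; omega
  refine ⟨M.charpoly + C (2 * ∏ i, b i), (Matrix.charpoly_monic M).add_of_left hlt, ?_, ?_⟩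
  · rw [natDegree_add_C, hdeg]
  · intro w hw x
    rw [det_diff m (by omega) a b w x hw, Polynomial.map_add, ← Matrix.charpoly_map, ← hM,
      eval_add, Matrix.eval_charpoly]
    simp [Matrix.smul_one_eq_diagonal]
end

section
/- For every w ∈ ℂ ∖ {0} and every x ∈ ℂ: x is an eigenvalue of L(w) (i.e. det(x·I_n − L(w)) = 0) if and only if w is an eigenvalue of the monodromy matrix M(x) (i.e. det(w·I_2 − M(x)) = 0); equivalently, since det M(x) = 1, if and only if w² − tr M(x)·w + 1 = 0. -/
open Matrix Polynomial

noncomputable section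

/-- The cyclically previous index in `Fin n` (so `prevIdx 0 = n-1`, matching
`b₀ := bₙ`). -/
def prevIdx {n : ℕ} (i : Fin n) : Fin n :=
  ⟨((i : ℕ) + n - 1) % n, Nat.mod_lt _ i.pos⟩

/-- The transfer matrix `Tᵢ(x)` of the periodic discrete Schrödinger operator:
first row `(0, 1)`, second row `(−b_{i−1}/bᵢ, (x − aᵢ)/bᵢ)`. -/
def transferMat {n : ℕ} (a b : Fin n → ℝ) (i : Fin n) (x : ℂ) :
    Matrix (Fin 2) (Fin 2) ℂ :=
  !![0, 1; (-(b (prevIdx i)) / b i : ℝ), (x - (a i : ℂ)) / (b i : ℂ)]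

/-- The monodromy matrix `M(x) = Tₙ(x)·T_{n−1}(x)⋯T₁(x)`. -/
def monodromy (n : ℕ) (a b : Fin n → ℝ) (x : ℂ) : Matrix (Fin 2) (Fin 2) ℂ :=
  ((List.finRange n).reverse.map fun i => transferMat a b i x).prod

end

/-- Transfer matrix with a natural-number index. -/
noncomputable def tNat (n : ℕ) (a b : Fin n → ℝ) (x : ℂ) (k : ℕ) : Matrix (Fin 2) (Fin 2) ℂ :=
  if h : k < n then transferMat a b ⟨k, h⟩ x else 1

/-- Partial products of transfer matrices. -/
noncomputable def pNat (n : ℕ) (a b : Fin n → ℝ) (x : ℂ) : ℕ → Matrix (Fin 2) (Fin 2) ℂ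
  | 0 => 1
  | k + 1 => tNat n a b x k * pNat n a b x k

theorem pNat_eq (n : ℕ) (a b : Fin n → ℝ) (x : ℂ) (k : ℕ) :
    ((List.range k).reverse.map (tNat n a b x)).prod = pNat n a b x k := by
  induction k with
  | zero => simp [pNat]
  | succ k ih => simp [List.range_succ, pNat, ← ih]

theorem monodromy_eq (n : ℕ) (a b : Fin n → ℝ) (x : ℂ) :
    monodromy n a b x = pNat n a b x n := by
  rw [← pNat_eq, monodromy]
  have h : List.range n = (List.finRange n).map Fin.val := by simp
  rw [h, ← List.map_reverse, List.map_map]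
  congr 2
  funext i
  simp [tNat]

theorem prevIdx_inj (n : ℕ) : Function.Injective (prevIdx (n := n)) := by
  intro i j h
  have hi := i.2
  have hj := j.2
  simp only [prevIdx, Fin.mk.injEq] at h
  have key : ∀ m : ℕ, m < n → (m + n - 1) % n = if m = 0 then n - 1 else m - 1 := by
    intro m hm
    split_ifs with h0
    · subst h0
      rw [Nat.zero_add]
      exact Nat.mod_eq_of_lt (by omega)
    · have : m + n - 1 = (m - 1) + n := by omega
      rw [this, Nat.add_mod_right]
      exact Nat.mod_eq_of_lt (by omega)
  rw [key _ hi, key _ hj] at h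
  apply Fin.ext
  split_ifs at h <;> omega

theorem monodromy_det (n : ℕ) (a b : Fin n → ℝ) (hb : ∀ i, 0 < b i) (x : ℂ) :
    (monodromy n a b x).det = 1 := by
  have h1 : (monodromy n a b x).det = ∏ i, (transferMat a b i x).det := by
    rw [monodromy, ← Matrix.coe_detMonoidHom, map_list_prod, List.map_map, List.map_reverse,
      List.prod_reverse, ← List.ofFn_eq_map, List.prod_ofFn]
    rfl
  have h2 : ∀ i, (transferMat a b i x).det = (b (prevIdx i) : ℂ) / b i := by
    intro i
    simp [transferMat, Matrix.det_fin_two, neg_div]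
  rw [h1, Finset.prod_congr rfl (fun i _ => h2 i), Finset.prod_div_distrib]
  have hbij : Function.Bijective (prevIdx (n := n)) :=
    Finite.injective_iff_bijective.mp (prevIdx_inj n)
  rw [hbij.prod_comp (fun i => (b i : ℂ))]
  apply div_self
  rw [Finset.prod_ne_zero_iff]
  intro i _
  exact_mod_cast ne_of_gt (hb i)

/-- The cyclically next index. -/
def nextIdx {n : ℕ} (i : Fin n) : Fin n :=
  if h : (i : ℕ) + 1 < n then ⟨i + 1, h⟩ else ⟨0, i.pos⟩

theorem prevIdx_val {n : ℕ} (i : Fin n) :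
    (prevIdx i : ℕ) = if (i : ℕ) = 0 then n - 1 else (i : ℕ) - 1 := by
  have hm := i.2
  simp only [prevIdx]
  split_ifs with h0
  · rw [h0, Nat.zero_add]
    exact Nat.mod_eq_of_lt (by omega)
  · have : (i : ℕ) + n - 1 = (i - 1) + n := by omega
    rw [this, Nat.add_mod_right]
    exact Nat.mod_eq_of_lt (by omega)

theorem nextIdx_val {n : ℕ} (i : Fin n) :
    (nextIdx i : ℕ) = if (i : ℕ) + 1 < n then (i : ℕ) + 1 else 0 := by
  unfold nextIdx
  split_ifs <;> rfl

theorem Lw_mulVec (n : ℕ) (hn : 3 ≤ n) (a b : Fin n → ℝ) (w : ℂ) (v : Fin n → ℂ) (i : Fin n) :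
    (Lw n a b w *ᵥ v) i = a i * v i
      + (if (i : ℕ) + 1 < n then 1 else w) * b i * v (nextIdx i)
      + (if (i : ℕ) = 0 then w⁻¹ else 1) * b (prevIdx i) * v (prevIdx i) := by
  have key : ∀ j, Lw n a b w i j * v j = (if j = i then a i * v i else 0)
      + (if j = nextIdx i then
          (if (i : ℕ) + 1 < n then 1 else w) * b i * v (nextIdx i) else 0)
      + (if j = prevIdx i then
          (if (i : ℕ) = 0 then w⁻¹ else 1) * b (prevIdx i) * v (prevIdx i) else 0) := by
    intro j
    have hi := i.2
    have hj := j.2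
    have hN := nextIdx_val i
    have hP := prevIdx_val i
    by_cases c1 : j = i
    · have e1 : j ≠ nextIdx i := by
        intro h; rw [← h, c1] at hN; split_ifs at hN <;> omega
      have e2 : j ≠ prevIdx i := by
        intro h; rw [← h, c1] at hP; split_ifs at hP <;> omega
      rw [if_pos c1, if_neg e1, if_neg e2, c1]
      simp [Lw]
    have d1 : (i : ℕ) ≠ j := fun h => c1 (Fin.ext h.symm)
    by_cases c2 : j = nextIdx i
    · have e2 : j ≠ prevIdx i := by
        intro h; rw [← h] at hP; rw [← c2] at hN; split_ifs at hN hP <;> omega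
      rw [if_neg c1, if_pos c2, if_neg e2, ← c2]
      rw [← c2] at hN
      unfold Lw
      rw [if_neg d1]
      split_ifs at hN ⊢ <;> first | omega | simp
    by_cases c3 : j = prevIdx i
    · rw [if_neg c1, if_neg c2, if_pos c3, ← c3]
      rw [← c3] at hP
      have d2 : (j : ℕ) ≠ nextIdx i := fun h => c2 (Fin.ext h)
      rw [hN] at d2
      unfold Lw
      rw [if_neg d1]
      split_ifs at hP d2 ⊢ <;> first | omega | simp
    · rw [if_neg c1, if_neg c2, if_neg c3]
      have d2 : (j : ℕ) ≠ nextIdx i := fun h => c2 (Fin.ext h)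
      have d3 : (j : ℕ) ≠ prevIdx i := fun h => c3 (Fin.ext h)
      rw [hN] at d2
      rw [hP] at d3
      unfold Lw
      rw [if_neg d1]
      split_ifs at d2 d3 ⊢ <;> first | omega | simp
  simp only [Matrix.mulVec, dotProduct]
  rw [Finset.sum_congr rfl (fun j _ => key j)]
  simp [Finset.sum_add_distrib]

theorem pNat_mulVec (n : ℕ) (a b : Fin n → ℝ) (hb : ∀ i, 0 < b i) (x : ℂ) (y : ℕ → ℂ)
    (hy : ∀ i : Fin n, (b i : ℂ) * y (i + 2) = (x - a i) * y (i + 1) - b (prevIdx i) * y i)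
    (k : ℕ) (hk : k ≤ n) :
    pNat n a b x k *ᵥ ![y 0, y 1] = ![y k, y (k + 1)] := by
  induction k with
  | zero => simp [pNat]
  | succ k ih =>
    have hk' : k < n := hk
    rw [pNat, ← Matrix.mulVec_mulVec, ih hk'.le, tNat, dif_pos hk']
    have h := hy ⟨k, hk'⟩
    have hb0 : (b ⟨k, hk'⟩ : ℂ) ≠ 0 := by exact_mod_cast ne_of_gt (hb _)
    simp only at h
    have h' : y (k + 2) = ((x - a ⟨k, hk'⟩) * y (k + 1) - b (prevIdx ⟨k, hk'⟩) * y k)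
        / b ⟨k, hk'⟩ := by
      rw [← h]; field_simp
    ext j
    fin_cases j
    · simp [transferMat, Matrix.mulVec, dotProduct]
    · simp [transferMat, Matrix.mulVec, dotProduct, h']
      ring

theorem main_iff (n : ℕ) (hn : 3 ≤ n) (a b : Fin n → ℝ) (hb : ∀ i, 0 < b i)
    (w : ℂ) (hw : w ≠ 0) (x : ℂ) :
    (x • (1 : Matrix (Fin n) (Fin n) ℂ) - Lw n a b w).det = 0 ↔
      (w • (1 : Matrix (Fin 2) (Fin 2) ℂ) - monodromy n a b x).det = 0 := by
  rw [← Matrix.exists_mulVec_eq_zero_iff, ← Matrix.exists_mulVec_eq_zero_iff, monodromy_eq]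
  constructor
  · rintro ⟨v, hv0, hv⟩
    have hrow : ∀ i, x * v i = (Lw n a b w *ᵥ v) i := by
      intro i
      have := congrFun hv i
      simp only [Matrix.sub_mulVec, Matrix.smul_mulVec, Matrix.one_mulVec, Pi.sub_apply,
        Pi.smul_apply, smul_eq_mul, Pi.zero_apply] at this
      exact sub_eq_zero.mp this
    let y : ℕ → ℂ := fun k => if k = 0 then w⁻¹ * v ⟨n - 1, by omega⟩
      else if h : k - 1 < n then v ⟨k - 1, h⟩ else w * v ⟨0, by omega⟩
    have y0 : y 0 = w⁻¹ * v ⟨n - 1, by omega⟩ := by simp [y]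
    have ys : ∀ k (h : k < n), y (k + 1) = v ⟨k, h⟩ := by
      intro k h; simp [y, h]
    have yn : y (n + 1) = w * v ⟨0, by omega⟩ := by simp [y]
    have hy : ∀ i : Fin n,
        (b i : ℂ) * y (i + 2) = (x - a i) * y (i + 1) - b (prevIdx i) * y i := by
      intro i
      have h := hrow i
      rw [Lw_mulVec n hn] at h
      have e1 : y (i + 1) = v i := ys i i.2
      have e2 : y (i + 2) = (if (i : ℕ) + 1 < n then 1 else w) * v (nextIdx i) := by
        by_cases c : (i : ℕ) + 1 < n
        · rw [if_pos c, ys _ c, one_mul, nextIdx, dif_pos c]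
        · have : (i : ℕ) + 2 = n + 1 := by omega
          rw [if_neg c, this, yn, nextIdx, dif_neg c]
      have e0 : y i = (if (i : ℕ) = 0 then w⁻¹ else 1) * v (prevIdx i) := by
        have hP := prevIdx_val i
        by_cases c : (i : ℕ) = 0
        · rw [if_pos c] at hP ⊢
          rw [c, y0]
          congr 2
          exact Fin.ext hP.symm
        · rw [if_neg c] at hP ⊢
          have : (i : ℕ) = (i - 1) + 1 := by omega
          rw [this, ys _ (by omega), one_mul]
          congr 1
          exact Fin.ext hP.symm
      rw [e0, e1, e2]
      linear_combination -h
    have hP := pNat_mulVec n a b hb x y hy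
    have hyn : y n = w * y 0 := by
      have := ys (n - 1) (by omega)
      rw [show n - 1 + 1 = n by omega] at this
      rw [this, y0]; field_simp
    have hyn1 : y (n + 1) = w * y 1 := by
      rw [yn, ← ys 0 (by omega)]
    refine ⟨![y 0, y 1], ?_, ?_⟩
    · intro h0
      apply hv0
      funext i
      have := hP i i.2.le
      rw [h0, Matrix.mulVec_zero] at this
      have := congrFun this 1
      simp only [Pi.zero_apply, Matrix.cons_val_one, Matrix.cons_val_zero] at this
      rw [Pi.zero_apply, this, ys i i.2]
    · rw [Matrix.sub_mulVec, hP n le_rfl, Matrix.smul_mulVec, Matrix.one_mulVec, hyn, hyn1]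
      ext j
      fin_cases j <;> simp
  · rintro ⟨u, hu0, hu⟩
    have hM : pNat n a b x n *ᵥ u = w • u := by
      rw [Matrix.sub_mulVec, Matrix.smul_mulVec, Matrix.one_mulVec] at hu
      exact (sub_eq_zero.mp hu).symm
    let s : ℕ → Fin 2 → ℂ := fun k => pNat n a b x k *ᵥ u
    have s0 : s 0 = u := Matrix.one_mulVec u
    have sn : s n = w • u := hM
    have ss : ∀ i : Fin n, s (i + 1) = transferMat a b i x *ᵥ s i := by
      intro i
      simp only [s]
      rw [pNat, tNat, dif_pos i.2, Matrix.mulVec_mulVec]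
    have ssa : ∀ i : Fin n, s (i + 1) 0 = s i 1 := by
      intro i
      rw [ss]; simp [transferMat, Matrix.mulVec, dotProduct]
    have ssb : ∀ i : Fin n,
        (b i : ℂ) * s (i + 1) 1 = (x - a i) * s i 1 - b (prevIdx i) * s i 0 := by
      intro i
      have hb0 : (b i : ℂ) ≠ 0 := by exact_mod_cast ne_of_gt (hb _)
      rw [ss]; simp [transferMat, Matrix.mulVec, dotProduct]
      field_simp
      ring
    have hlast : s (n - 1) 1 = w * u 0 := by
      have := ssa ⟨n - 1, by omega⟩
      simp only [show n - 1 + 1 = n by omega] at this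
      rw [← this, sn]; simp
    refine ⟨fun i => s i 1, ?_, ?_⟩
    · intro h0
      apply hu0
      have h1 : u 1 = 0 := by
        have := congrFun h0 ⟨0, by omega⟩
        simpa [s0] using this
      have h2 : u 0 = 0 := by
        have := congrFun h0 ⟨n - 1, by omega⟩
        simp only [hlast, Pi.zero_apply] at this
        exact (mul_eq_zero.mp this).resolve_left hw
      ext j
      fin_cases j
      · exact h2
      · exact h1
    · funext i
      rw [Matrix.sub_mulVec, Matrix.smul_mulVec, Matrix.one_mulVec, Pi.sub_apply,
        Lw_mulVec n hn]
      have e2 : s (i + 1) 1 = (if (i : ℕ) + 1 < n then 1 else w) * s (nextIdx i) 1 := by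
        have hN := nextIdx_val i
        by_cases c : (i : ℕ) + 1 < n
        · rw [if_pos c] at hN ⊢
          rw [hN, one_mul]
        · rw [if_neg c] at hN ⊢
          rw [hN, s0, show (i : ℕ) + 1 = n by omega, sn]; simp
      have e0 : s i 0 = (if (i : ℕ) = 0 then w⁻¹ else 1) * s (prevIdx i) 1 := by
        have hP := prevIdx_val i
        by_cases c : (i : ℕ) = 0
        · rw [if_pos c] at hP ⊢
          rw [hP, c, hlast, s0]; field_simp
        · rw [if_neg c] at hP ⊢
          have h := ssa (prevIdx i)
          rw [hP, show (i : ℕ) - 1 + 1 = i by omega] at h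
          rw [h, one_mul, hP]
      have h := ssb i
      rw [e2, e0] at h
      simp only [Pi.smul_apply, smul_eq_mul, Pi.zero_apply]
      linear_combination -h

/-- `x` is an eigenvalue of `L(w)` iff `w` is an eigenvalue of the
monodromy matrix `M(x)`; equivalently iff `w² − tr M(x)·w + 1 = 0`. -/
theorem statement15 (n : ℕ) (hn : 3 ≤ n) (a b : Fin n → ℝ) (hb : ∀ i, 0 < b i) :
    ∀ w : ℂ, w ≠ 0 → ∀ x : ℂ,
      ((x • (1 : Matrix (Fin n) (Fin n) ℂ) - Lw n a b w).det = 0 ↔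
        (w • (1 : Matrix (Fin 2) (Fin 2) ℂ) - monodromy n a b x).det = 0) ∧
      ((x • (1 : Matrix (Fin n) (Fin n) ℂ) - Lw n a b w).det = 0 ↔
        w ^ 2 - (monodromy n a b x).trace * w + 1 = 0) := by
  intro w hw x
  have h := main_iff n hn a b hb w hw x
  refine ⟨h, h.trans ?_⟩
  have hd := monodromy_det n a b hb x
  have e : (w • (1 : Matrix (Fin 2) (Fin 2) ℂ) - monodromy n a b x).det
      = w ^ 2 - (monodromy n a b x).trace * w + 1 := by
    rw [← hd, Matrix.det_fin_two, Matrix.det_fin_two, Matrix.trace_fin_two]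
    simp
    ring
  rw [e]
end

section
/- Let N' ⊆ N be the subgroup generated by the n−1 vectors β_k = α_k − α_{k+1}, k = 1,…,n−1. Then the quotient group N/N' is cyclic of order n, i.e. N/N' ≅ ℤ/nℤ. -/
/-- `αᵢ = (n−1)εᵢ − ∑_{j≠i} εⱼ`: the vector with `n−1` in coordinate `i` and `−1`
elsewhere. -/
def alphaVec (n : ℕ) (i : Fin n) : Fin n → ℤ :=
  fun j => if j = i then (n : ℤ) - 1 else -1

/-- The lattice `N = {a ∈ ℤⁿ : ∑ aᵢ = 0 and aᵢ ≡ aⱼ (mod n) for all i,j}`. -/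
def NLat (n : ℕ) : AddSubgroup (Fin n → ℤ) where
  carrier := {a | (∑ i, a i = 0) ∧ ∀ i j, (n : ℤ) ∣ a i - a j}
  zero_mem' := by
    refine ⟨by simp, fun i j => by simp⟩
  add_mem' := by
    rintro a b ⟨ha1, ha2⟩ ⟨hb1, hb2⟩
    refine ⟨?_, fun i j => ?_⟩
    · simpa [Finset.sum_add_distrib] using by rw [ha1, hb1]; ring
    · have h := dvd_add (ha2 i j) (hb2 i j)
      have : a i - a j + (b i - b j) = (a + b) i - (a + b) j := by
        simp [Pi.add_apply]; ring
      rwa [this] at h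
  neg_mem' := by
    rintro a ⟨ha1, ha2⟩
    refine ⟨by simp [ha1], fun i j => ?_⟩
    have h := ha2 j i
    have : a j - a i = (-a) i - (-a) j := by simp [Pi.neg_apply]; ring
    rwa [this] at h

/-- The sublattice `N' ⊆ ℤⁿ` generated by the vectors `βₖ = αₖ − α_{k+1}`,
`k = 1, …, n−1`. -/
def NprimeLat (n : ℕ) : AddSubgroup (Fin n → ℤ) :=
  AddSubgroup.closure
    {x : Fin n → ℤ | ∃ (k : Fin n) (h : (k : ℕ) + 1 < n),
      x = alphaVec n k - alphaVec n ⟨(k : ℕ) + 1, h⟩}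

theorem alpha_sub_mem (n : ℕ) (hn : 0 < n) (k : ℕ) (hk : k < n) :
    alphaVec n ⟨k, hk⟩ - alphaVec n ⟨0, hn⟩ ∈ NprimeLat n := by
  induction k with
  | zero => simp [(NprimeLat n).zero_mem]
  | succ k ih =>
    have h1 := ih (by omega)
    have h2 : alphaVec n ⟨k, by omega⟩ - alphaVec n ⟨k + 1, hk⟩ ∈ NprimeLat n :=
      AddSubgroup.subset_closure ⟨⟨k, by omega⟩, hk, rfl⟩
    have h3 := (NprimeLat n).sub_mem h1 h2
    convert h3 using 1
    abel

theorem mem_prime_of_dvd (n : ℕ) (hn : 0 < n) (a : Fin n → ℤ) (ha : ∑ i, a i = 0)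
    (hd : ∀ i, (n : ℤ) ∣ a i) : a ∈ NprimeLat n := by
  choose b hb using hd
  have hn' : (n : ℤ) ≠ 0 := by exact_mod_cast hn.ne'
  have hbs : ∑ i, b i = 0 := by
    have : (n : ℤ) * ∑ i, b i = 0 := by
      rw [Finset.mul_sum, ← ha]
      exact Finset.sum_congr rfl fun i _ => (hb i).symm
    exact (mul_eq_zero.mp this).resolve_left hn'
  have key : a = ∑ i, b i • (alphaVec n i - alphaVec n ⟨0, hn⟩) := by
    have h1 : ∑ i, b i • (alphaVec n i - alphaVec n ⟨0, hn⟩) = ∑ i, b i • alphaVec n i := by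
      simp only [smul_sub, Finset.sum_sub_distrib, ← Finset.sum_smul, hbs, zero_smul, sub_zero]
    rw [h1]
    funext j
    have h2 : ∀ i, b i * alphaVec n i j = (if j = i then (n : ℤ) * b i else 0) - b i := by
      intro i
      unfold alphaVec
      split_ifs <;> ring
    simp only [Finset.sum_apply, Pi.smul_apply, smul_eq_mul, h2, Finset.sum_sub_distrib, hbs]
    simp [hb j]
  rw [key]
  exact (NprimeLat n).sum_mem fun i _ =>
    (NprimeLat n).zsmul_mem (alpha_sub_mem n hn i.1 i.2) _

/-- Reduction of the zeroth coordinate mod `n`. -/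
def redMap (n : ℕ) (hn : 0 < n) : ↥(NLat n) →+ ZMod n where
  toFun a := ((a.1 ⟨0, hn⟩ : ℤ) : ZMod n)
  map_zero' := by simp
  map_add' a b := by simp

theorem dvd_of_mem_prime (n : ℕ) (a : Fin n → ℤ) (ha : a ∈ NprimeLat n) :
    ∀ i, (n : ℤ) ∣ a i := by
  unfold NprimeLat at ha
  induction ha using AddSubgroup.closure_induction with
  | mem x hx =>
    obtain ⟨k, h, rfl⟩ := hx
    intro i
    simp only [Pi.sub_apply, alphaVec]
    split_ifs <;> first | (refine ⟨0, ?_⟩; ring1) | (refine ⟨1, ?_⟩; ring1) | (refine ⟨-1, ?_⟩; ring1)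
  | zero => simp
  | add x y _ _ hx hy => exact fun i => dvd_add (hx i) (hy i)
  | neg x _ hx => exact fun i => (dvd_neg.mpr (hx i))

theorem alpha_mem (n : ℕ) (i : Fin n) : alphaVec n i ∈ NLat n := by
  refine ⟨?_, fun j k => ?_⟩
  · have h2 : ∀ j, alphaVec n i j = (if j = i then (n : ℤ) else 0) - 1 := by
      intro j
      unfold alphaVec
      split_ifs <;> ring
    simp [h2]
  · unfold alphaVec
    split_ifs <;> first | (refine ⟨0, ?_⟩; ring1) | (refine ⟨1, ?_⟩; ring1) | (refine ⟨-1, ?_⟩; ring1)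

theorem redMap_ker (n : ℕ) (hn : 0 < n) :
    (redMap n hn).ker = (NprimeLat n).addSubgroupOf (NLat n) := by
  ext a
  rw [AddMonoidHom.mem_ker, AddSubgroup.mem_addSubgroupOf]
  change ((a.1 ⟨0, hn⟩ : ℤ) : ZMod n) = 0 ↔ _
  rw [CharP.intCast_eq_zero_iff (ZMod n) n]
  constructor
  · intro h
    refine mem_prime_of_dvd n hn a.1 a.2.1 fun i => ?_
    have := dvd_add (a.2.2 i ⟨0, hn⟩) h
    simpa using this
  · intro h
    exact dvd_of_mem_prime n a.1 h _

theorem redMap_surj (n : ℕ) (hn : 0 < n) : Function.Surjective (redMap n hn) := by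
  intro z
  obtain ⟨m, rfl⟩ := ZMod.intCast_surjective z
  refine ⟨(-m) • ⟨alphaVec n ⟨0, hn⟩, alpha_mem n _⟩, ?_⟩
  rw [map_zsmul]
  simp [redMap, alphaVec]

/-- the quotient `N/N'` is cyclic of order `n`. -/
theorem statement17 (n : ℕ) (hn : 3 ≤ n) :
    Nonempty ((↥(NLat n) ⧸ (NprimeLat n).addSubgroupOf (NLat n)) ≃+ ZMod n) := by
  have h0 : 0 < n := by omega
  exact ⟨(QuotientAddGroup.quotientAddEquivOfEq (redMap_ker n h0).symm).trans
    (QuotientAddGroup.quotientKerEquivOfSurjective (redMap n h0) (redMap_surj n h0))⟩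
end

section
/- Let n ≥ 2 and let F be a monic real polynomial of degree n having n distinct real roots. Then the following are equivalent: (i) F takes the same value at all of its local maximum points and the same value at all of its local minimum points; (ii) there exist reals α, β, γ, δ with α ≠ 0 and γ ≠ 0 such that F(x) = γ·T_n(αx + β) + δ for all x ∈ ℝ, where T_n is the degree-n Chebyshev polynomial of the first kind. -/
open Polynomial

lemma aux_not_const (P : ℝ[X]) (hP : 0 < P.natDegree) (c a b : ℝ) (hab : a < b)
    (h : ∀ x ∈ Set.Ioo a b, P.eval x = c) : False := by
  have : P = C c := by
    apply eq_of_infinite_eval_eq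
    apply (Set.Ioo_infinite hab).mono
    intro x hx
    simpa using h x hx
  rw [this] at hP
  simp at hP

lemma aux_not_const_nhds (P : ℝ[X]) (hP : 0 < P.natDegree) (c u : ℝ)
    (h : ∀ᶠ x in nhds u, P.eval x = c) : False := by
  obtain ⟨e, he, h⟩ := Metric.eventually_nhds_iff.1 h
  refine aux_not_const P hP c (u - e) (u + e) (by linarith) fun x hx => h ?_
  rw [Real.dist_eq, abs_lt]
  constructor <;> linarith [hx.1, hx.2]

lemma aux_T_max (n : ℕ) (hn : 2 ≤ n) (u : ℝ)
    (h : IsLocalMax (fun t => (Chebyshev.T ℝ (n : ℤ)).eval t) u) :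
    (Chebyshev.T ℝ (n : ℤ)).eval u = 1 := by
  obtain ⟨k, hk, hu⟩ := (Chebyshev.isLocalExtr_T_real_iff hn u).1 (Or.inr h)
  rw [Finset.mem_Ioo] at hk
  rcases k.even_or_odd with hk2 | hk2
  · exact (Chebyshev.eval_T_real_eq_one_iff (by omega) u).2 ⟨k, hk.2.le, hk2, hu⟩
  · exfalso
    have h2 := Chebyshev.isLocalMin_T_real (by omega) hk.2 hk2
    rw [← hu] at h2
    refine aux_not_const_nhds (Chebyshev.T ℝ (n : ℤ)) (by simp; omega)
      ((Chebyshev.T ℝ (n : ℤ)).eval u) u ?_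
    · filter_upwards [h, h2] with x h3 h4
      exact le_antisymm h3 h4

lemma aux_T_min (n : ℕ) (hn : 2 ≤ n) (u : ℝ)
    (h : IsLocalMin (fun t => (Chebyshev.T ℝ (n : ℤ)).eval t) u) :
    (Chebyshev.T ℝ (n : ℤ)).eval u = -1 := by
  obtain ⟨k, hk, hu⟩ := (Chebyshev.isLocalExtr_T_real_iff hn u).1 (Or.inl h)
  rw [Finset.mem_Ioo] at hk
  rcases k.even_or_odd with hk2 | hk2
  · exfalso
    have h2 := Chebyshev.isLocalMax_T_real (by omega) hk.1 hk.2 hk2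
    rw [← hu] at h2
    refine aux_not_const_nhds (Chebyshev.T ℝ (n : ℤ)) (by simp; omega)
      ((Chebyshev.T ℝ (n : ℤ)).eval u) u ?_
    · filter_upwards [h, h2] with x h3 h4
      exact le_antisymm h4 h3
  · exact (Chebyshev.eval_T_real_eq_neg_one_iff (by omega) u).2 ⟨k, hk.2.le, hk2, hu⟩

lemma aux_tendsto (α β x : ℝ) (hα : α ≠ 0) :
    Filter.Tendsto (fun u : ℝ => (u - β) / α) (nhds (α * x + β)) (nhds x) := by
  have h : Continuous (fun u : ℝ => (u - β) / α) := by fun_prop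
  have := h.tendsto (α * x + β)
  simpa [mul_div_cancel_left₀ x hα] using this

lemma aux_backward (n : ℕ) (hn : 2 ≤ n) (F : ℝ[X]) (α β γ δ : ℝ) (hα : α ≠ 0) (hγ : γ ≠ 0)
    (hF : ∀ x : ℝ, F.eval x = γ * (Chebyshev.T ℝ (n : ℤ)).eval (α * x + β) + δ) :
    (∀ x, IsLocalMax (fun t => F.eval t) x → F.eval x = |γ| + δ) ∧
    (∀ x, IsLocalMin (fun t => F.eval t) x → F.eval x = -|γ| + δ) := by
  have key : ∀ u : ℝ, F.eval ((u - β) / α) = γ * (Chebyshev.T ℝ (n : ℤ)).eval u + δ := by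
    intro u
    rw [hF]
    congr 3
    field_simp
    ring
  constructor
  · intro x hx
    have h1 := (aux_tendsto α β x hα).eventually hx
    rcases lt_or_gt_of_ne hγ with hg | hg
    · have : IsLocalMin (fun t => (Chebyshev.T ℝ (n : ℤ)).eval t) (α * x + β) := by
        filter_upwards [h1] with u hu
        simp only [key, hF x] at hu
        nlinarith
      rw [hF, aux_T_min n hn _ this, abs_of_neg hg]; ring
    · have : IsLocalMax (fun t => (Chebyshev.T ℝ (n : ℤ)).eval t) (α * x + β) := by
        filter_upwards [h1] with u hu
        simp only [key, hF x] at hu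
        nlinarith
      rw [hF, aux_T_max n hn _ this, abs_of_pos hg]; ring
  · intro x hx
    have h1 := (aux_tendsto α β x hα).eventually hx
    rcases lt_or_gt_of_ne hγ with hg | hg
    · have : IsLocalMax (fun t => (Chebyshev.T ℝ (n : ℤ)).eval t) (α * x + β) := by
        filter_upwards [h1] with u hu
        simp only [key, hF x] at hu
        nlinarith
      rw [hF, aux_T_max n hn _ this, abs_of_neg hg]; ring
    · have : IsLocalMin (fun t => (Chebyshev.T ℝ (n : ℤ)).eval t) (α * x + β) := by
        filter_upwards [h1] with u hu
        simp only [key, hF x] at hu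
        nlinarith
      rw [hF, aux_T_min n hn _ this, abs_of_pos hg]; ring

lemma aux_tendsto_atTop (F : ℝ[X]) (hF : F.Monic) (hd : 0 < F.natDegree) :
    Filter.Tendsto (fun x => F.eval x) Filter.atTop Filter.atTop :=
  F.tendsto_atTop_of_leadingCoeff_nonneg (natDegree_pos_iff_degree_pos.1 hd)
    (by rw [hF.leadingCoeff]; norm_num)

/-- To the right of a local maximum there is a local minimum with smaller value. -/
lemma aux_min_of_max (F : ℝ[X]) (hF : F.Monic) (hd : 0 < F.natDegree) (a : ℝ)
    (ha : IsLocalMax (fun t => F.eval t) a) :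
    ∃ b, IsLocalMin (fun t => F.eval t) b ∧ F.eval b < F.eval a := by
  obtain ⟨z, hz, hFz⟩ : ∃ z > a, F.eval z < F.eval a := by
    by_contra! hcon
    obtain ⟨e, he, h⟩ := Metric.eventually_nhds_iff.1 ha
    refine aux_not_const F hd (F.eval a) a (a + e) (by linarith) fun x hx => ?_
    refine le_antisymm (h ?_) (hcon x hx.1)
    rw [Real.dist_eq, abs_lt]
    constructor <;> linarith [hx.1, hx.2]
  obtain ⟨R, hR1, hR2⟩ := (((aux_tendsto_atTop F hF hd).eventually_ge_atTop (F.eval a)).and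
    (Filter.eventually_gt_atTop z)).exists
  obtain ⟨y, hy, hmin⟩ := (isCompact_Icc (a := a) (b := R)).exists_isMinOn
    ⟨z, hz.le, hR2.le⟩ (f := fun t => F.eval t) F.continuous.continuousOn
  have hyz : F.eval y ≤ F.eval z := hmin ⟨hz.le, hR2.le⟩
  have h1 : y ≠ a := by rintro rfl; linarith
  have h2 : y ≠ R := by rintro rfl; linarith
  exact ⟨y, hmin.isLocalMin (Icc_mem_nhds (lt_of_le_of_ne hy.1 h1.symm)
    (lt_of_le_of_ne hy.2 h2)), by linarith⟩

lemma aux_dvd (D P : ℝ[X]) (hD : D.roots.toFinset.card = D.natDegree)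
    (h : ∀ c, D.eval c = 0 → P.eval c = 0) : D ∣ P := by
  by_cases hP : P = 0
  · simp [hP]
  have hle : D.roots.toFinset.card ≤ D.roots.card := Multiset.toFinset_card_le _
  have hcard : D.roots.card = D.natDegree := le_antisymm (card_roots' D) (hD ▸ hle)
  have hnd : D.roots.Nodup := Multiset.toFinset_card_eq_card_iff_nodup.1 (hD.trans hcard.symm)
  by_cases hD0 : D = 0
  · exact absurd (eq_of_infinite_eval_eq P 0 (by
      apply Set.infinite_univ.mono
      intro x _
      simpa using h x (by simp [hD0]))) hP
  rw [← C_leadingCoeff_mul_prod_multiset_X_sub_C hcard]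
  have hu : IsUnit (C D.leadingCoeff) := by
    rw [isUnit_C]; exact (leadingCoeff_ne_zero.2 hD0).isUnit
  rw [hu.mul_left_dvd, Multiset.prod_X_sub_C_dvd_iff_le_roots hP,
    Multiset.le_iff_subset hnd]
  intro c hc
  rw [mem_roots hP]
  exact h c (by simpa using (mem_roots hD0).1 hc)

lemma aux_simple (D : ℝ[X]) (hD : D.roots.toFinset.card = D.natDegree) (hD0 : D ≠ 0)
    (c : ℝ) (hc : D.eval c = 0) : (derivative D).eval c ≠ 0 := by
  have hle : D.roots.toFinset.card ≤ D.roots.card := Multiset.toFinset_card_le _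
  have hcard : D.roots.card = D.natDegree := le_antisymm (card_roots' D) (hD ▸ hle)
  have hnd : D.roots.Nodup := Multiset.toFinset_card_eq_card_iff_nodup.1 (hD.trans hcard.symm)
  intro h
  have h1 := (one_lt_rootMultiplicity_iff_isRoot hD0 (t := c)).2 ⟨hc, h⟩
  rw [← count_roots] at h1
  have := Multiset.nodup_iff_count_le_one.1 hnd c
  omega

lemma aux_coeff (K : ℝ[X]) (k : ℕ) : (X * derivative K).coeff k = k * K.coeff k := by
  cases k with
  | zero => simp
  | succ k => rw [coeff_X_mul, coeff_derivative]; push_cast; ring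

/-- Uniqueness for the Chebyshev differential equation. -/
lemma aux_ode (n : ℕ) (K : ℝ[X]) (hdeg : K ≠ 0 → K.natDegree < n)
    (h : (1 - X ^ 2) * derivative (derivative K) - X * derivative K + C ((n : ℝ) ^ 2) * K = 0) :
    K = 0 := by
  by_contra hK
  have hlt := hdeg hK
  have h2 : derivative (derivative K) - X * derivative (X * derivative K)
      + C ((n : ℝ) ^ 2) * K = 0 := by
    rw [← h, derivative_mul, derivative_X]; ring
  have h3 := congrArg (fun p => p.coeff K.natDegree) h2
  simp only [coeff_add, coeff_sub, aux_coeff, coeff_C_mul, coeff_zero, coeff_derivative] at h3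
  rw [coeff_eq_zero_of_natDegree_lt (n := K.natDegree + 1 + 1) (by omega)] at h3
  have h4 : ((n : ℝ) ^ 2 - (K.natDegree : ℝ) ^ 2) * K.coeff K.natDegree = 0 := by
    linear_combination h3
  have h5 : (K.natDegree : ℝ) < n := by exact_mod_cast hlt
  have h6 : (0 : ℝ) ≤ K.natDegree := by positivity
  rcases mul_eq_zero.1 h4 with h7 | h7
  · nlinarith
  · exact hK (leadingCoeff_eq_zero.1 h7)

/-- Solving the transported Chebyshev equation. -/
lemma aux_solve (n : ℕ) (hn : 2 ≤ n) (G : ℝ[X]) (hG : G.natDegree = n) (p s : ℝ) (hs : s ≠ 0)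
    (h : C ((n : ℝ) ^ 2) * G = ((X - C p) ^ 2 - C (s ^ 2)) * derivative (derivative G)
      + (X - C p) * derivative G) :
    ∃ γ : ℝ, γ ≠ 0 ∧ ∀ x, G.eval x = γ * (Chebyshev.T ℝ (n : ℤ)).eval (s⁻¹ * x + -(p * s⁻¹)) := by
  set H : ℝ[X] := G.comp (C s * X + C p) with hH
  have hlin : (C s * X + C p).natDegree = 1 := natDegree_linear hs
  have hHd : H.natDegree = n := by rw [hH, natDegree_comp, hlin, hG, mul_one]
  have hH0 : H ≠ 0 := by rintro h0; rw [h0] at hHd; simp at hHd; omega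
  have d1 : derivative H = C s * (derivative G).comp (C s * X + C p) := by
    rw [hH, derivative_comp]; simp
  have d2 : derivative (derivative H)
      = C (s ^ 2) * (derivative (derivative G)).comp (C s * X + C p) := by
    rw [d1, derivative_C_mul, derivative_comp]; simp; ring
  have hode : (1 - X ^ 2) * derivative (derivative H) - X * derivative H
      + C ((n : ℝ) ^ 2) * H = 0 := by
    have h1 := congrArg (fun q => q.comp (C s * X + C p)) h
    simp only [mul_comp, add_comp, sub_comp, pow_comp, X_comp, C_comp] at h1
    rw [d2, d1, h1]
    simp only [C_pow]
    ring
  set T := Chebyshev.T ℝ (n : ℤ) with hT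
  have hTd : T.natDegree = n := by simp [hT]
  have hT0 : T ≠ 0 := Chebyshev.T_ne_zero ℝ n
  have hTode : (1 - X ^ 2) * derivative (derivative T) - X * derivative T
      + C ((n : ℝ) ^ 2) * T = 0 := by
    have h1 := Chebyshev.one_sub_X_sq_mul_derivative_derivative_T_eq_poly_in_T (R := ℝ) (n : ℤ)
    simp only [Function.iterate_succ, Function.iterate_zero, Function.comp_apply, id] at h1
    rw [← hT] at h1
    rw [h1]
    simp
  have hTl : T.leadingCoeff ≠ 0 := leadingCoeff_ne_zero.2 hT0
  have hHl : H.leadingCoeff ≠ 0 := leadingCoeff_ne_zero.2 hH0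
  refine ⟨H.leadingCoeff / T.leadingCoeff, div_ne_zero hHl hTl, ?_⟩
  set g := H.leadingCoeff / T.leadingCoeff with hg
  have hK : H - C g * T = 0 := by
    apply aux_ode n
    · intro hK
      rw [← hHd]
      refine natDegree_lt_natDegree hK (degree_sub_lt_left ?_ hH0 ?_)
      · rw [degree_C_mul (div_ne_zero hHl hTl), degree_eq_natDegree hH0, degree_eq_natDegree hT0,
          hHd, hTd]
      · rw [leadingCoeff_mul, leadingCoeff_C, hg, div_mul_cancel₀ _ hTl]
    · simp only [derivative_sub, derivative_C_mul]
      linear_combination hode - C g * hTode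
  intro x
  have h1 := congrArg (fun q => q.eval (s⁻¹ * x + -(p * s⁻¹))) (sub_eq_zero.1 hK)
  simp only [hH, eval_comp, eval_add, eval_mul, eval_C, eval_X] at h1
  rw [← h1]
  congr 1
  field_simp
  ring

lemma aux_forward (n : ℕ) (hn : 2 ≤ n) (F : ℝ[X])
    (hmonic : F.Monic) (hdeg : F.natDegree = n) (hroots : F.roots.toFinset.card = n)
    (hmax : ∀ x y : ℝ, IsLocalMax (fun t => F.eval t) x → IsLocalMax (fun t => F.eval t) y →
        F.eval x = F.eval y)
    (hmin : ∀ x y : ℝ, IsLocalMin (fun t => F.eval t) x → IsLocalMin (fun t => F.eval t) y →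
        F.eval x = F.eval y) :
    ∃ α β γ δ : ℝ, α ≠ 0 ∧ γ ≠ 0 ∧
      ∀ x : ℝ, F.eval x = γ * (Chebyshev.T ℝ (n : ℤ)).eval (α * x + β) + δ := by
  have hdpos : 0 < F.natDegree := by omega
  have hn0 : (n : ℝ) ≠ 0 := by positivity
  set D := derivative F with hD
  have hDdeg : D.natDegree = n - 1 := by rw [hD, natDegree_derivative, hdeg]
  have hD0 : D ≠ 0 := by rintro h0; rw [h0] at hDdeg; simp at hDdeg; omega
  have hDl : D.leadingCoeff = n := by
    rw [leadingCoeff, hDdeg, hD, coeff_derivative, show n - 1 + 1 = n by omega]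
    have : F.coeff n = 1 := by rw [← hdeg]; exact hmonic
    rw [this, Nat.cast_sub (by omega)]; simp
  have hDcard : D.roots.toFinset.card = D.natDegree := by
    have h1 := card_roots_toFinset_le_derivative F
    have h2 : D.roots.toFinset.card ≤ D.roots.card := Multiset.toFinset_card_le _
    have h3 := card_roots' D
    rw [← hD] at h1
    omega
  -- second derivative test
  have hcrit : ∀ c, D.eval c = 0 →
      IsLocalMax (fun t => F.eval t) c ∨ IsLocalMin (fun t => F.eval t) c := by
    intro c hc
    have h1 := aux_simple D hDcard hD0 c hc
    have e1 : deriv (fun t => F.eval t) = fun t => D.eval t := by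
      funext t; exact F.deriv
    have e2 : deriv (deriv (fun t => F.eval t)) c = (derivative D).eval c := by
      rw [e1]; exact D.deriv
    have e3 : deriv (fun t => F.eval t) c = 0 := by rw [e1]; exact hc
    rcases lt_or_gt_of_ne h1 with h | h
    · exact Or.inl (isLocalMax_of_deriv_deriv_neg (by rw [e2]; exact h) e3
        F.continuous.continuousAt)
    · exact Or.inr (isLocalMin_of_deriv_deriv_pos (by rw [e2]; exact h) e3
        F.continuous.continuousAt)
  -- a local minimum exists
  obtain ⟨b, hb⟩ : ∃ b, IsLocalMin (fun t => F.eval t) b := by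
    have : 0 < D.roots.toFinset.card := by omega
    obtain ⟨c, hc⟩ := Finset.card_pos.1 this
    rw [Multiset.mem_toFinset, mem_roots hD0] at hc
    rcases hcrit c hc with h | h
    · obtain ⟨b, hb, _⟩ := aux_min_of_max F hmonic hdpos c h
      exact ⟨b, hb⟩
    · exact ⟨c, h⟩
  set m := F.eval b with hm
  obtain ⟨M, hmM, hM⟩ : ∃ M, m < M ∧ ∀ a, IsLocalMax (fun t => F.eval t) a → F.eval a = M := by
    by_cases hex : ∃ a, IsLocalMax (fun t => F.eval t) a
    · obtain ⟨a, ha⟩ := hex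
      obtain ⟨b', hb', hlt⟩ := aux_min_of_max F hmonic hdpos a ha
      refine ⟨F.eval a, ?_, fun a' ha' => hmax a' a ha' ha⟩
      rw [hm, hmin b b' hb hb']; exact hlt
    · exact ⟨m + 1, by linarith, fun a ha => absurd ⟨a, ha⟩ hex⟩
  set P := (F - C M) * (F - C m) with hP
  have hP' : derivative P = D * (2 * F - C M - C m) := by
    rw [hP, derivative_mul, derivative_sub, derivative_sub, derivative_C, derivative_C]; ring
  have hPc : ∀ c, D.eval c = 0 → P.eval c = 0 := by
    intro c hc
    rcases hcrit c hc with h | h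
    · simp [hP, hM c h]
    · simp [hP, hm, hmin c b h hb]
  obtain ⟨R, hR⟩ := aux_dvd D P hDcard hPc
  obtain ⟨Q, hQ⟩ : D ∣ R := by
    apply aux_dvd D R hDcard
    intro c hc
    have h1 := hP'
    rw [hR, derivative_mul] at h1
    have h2 := congrArg (fun q => q.eval c) h1
    simp only [eval_add, eval_mul, hc, zero_mul, add_zero] at h2
    exact (mul_eq_zero.1 h2).resolve_left (aux_simple D hDcard hD0 c hc)
  have hPQ : P = D ^ 2 * Q := by rw [hR, hQ]; ring
  have hodeQ : 2 * F - C M - C m = 2 * derivative D * Q + D * derivative Q := by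
    apply mul_left_cancel₀ hD0
    rw [← hP', hPQ, sq, derivative_mul, derivative_mul]
    ring
  have hFM : ∀ v : ℝ, (F - C v).Monic ∧ (F - C v).natDegree = n := by
    intro v
    constructor
    · apply hmonic.sub_of_left
      exact lt_of_le_of_lt degree_C_le (natDegree_pos_iff_degree_pos.1 hdpos)
    · rw [natDegree_sub_C, hdeg]
  have hPm : P.Monic := (hFM M).1.mul (hFM m).1
  have hPd : P.natDegree = n + n := by
    rw [hP, (hFM M).1.natDegree_mul (hFM m).1, (hFM M).2, (hFM m).2]
  have hQ0 : Q ≠ 0 := by rintro rfl; rw [hPQ] at hPm; simp at hPm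
  have hQd : Q.natDegree = 2 := by
    rw [hPQ, natDegree_mul (pow_ne_zero _ hD0) hQ0, natDegree_pow, hDdeg] at hPd
    omega
  have hQl : (n : ℝ) ^ 2 * Q.coeff 2 = 1 := by
    have h1 := hPm.leadingCoeff
    rw [hPQ, leadingCoeff_mul, leadingCoeff_pow, hDl, leadingCoeff, hQd] at h1
    exact h1
  set B := Q.coeff 1 with hB
  set A := Q.coeff 0 with hA
  have hQform : C ((n : ℝ) ^ 2) * Q = (X - C (-((n : ℝ) ^ 2 * B / 2))) ^ 2
      - C (((n : ℝ) ^ 2 * B / 2) ^ 2 - (n : ℝ) ^ 2 * A) := by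
    have h1 := Q.as_sum_range_C_mul_X_pow
    rw [hQd] at h1
    simp only [Finset.sum_range_succ, Finset.sum_range_zero] at h1
    rw [← hA, ← hB] at h1
    apply Polynomial.funext
    intro x
    have h2 : Q.eval x = A + B * x + Q.coeff 2 * x ^ 2 := by
      conv_lhs => rw [h1]
      simp
    simp only [eval_mul, eval_sub, eval_pow, eval_X, eval_C, h2]
    linear_combination x ^ 2 * hQl
  set p := -((n : ℝ) ^ 2 * B / 2) with hp
  set d := ((n : ℝ) ^ 2 * B / 2) ^ 2 - (n : ℝ) ^ 2 * A with hd
  have hdp : 0 < d := by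
    obtain ⟨z, hz1, hz2⟩ := (((aux_tendsto_atTop F hmonic hdpos).eventually_ge_atTop M).and
      (Filter.eventually_ge_atTop b)).exists
    obtain ⟨x, -, hx⟩ := intermediate_value_Icc hz2
      (f := fun t => F.eval t) F.continuous.continuousOn
      (show (M + m) / 2 ∈ Set.Icc (F.eval b) (F.eval z) from ⟨by linarith, by linarith⟩)
    have h1 : P.eval x < 0 := by
      simp only [hP, eval_mul, eval_sub, eval_C]
      simp only at hx
      rw [hx]
      nlinarith [mul_pos (sub_pos.2 hmM) (sub_pos.2 hmM)]
    rw [hPQ, eval_mul, eval_pow] at h1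
    have h2 : Q.eval x < 0 := by
      by_contra! h3
      nlinarith [mul_nonneg (sq_nonneg (D.eval x)) h3]
    have h3 := congrArg (fun q => q.eval x) hQform
    simp only [eval_mul, eval_sub, eval_pow, eval_X, eval_C] at h3
    have h4 : (0 : ℝ) < (n : ℝ) ^ 2 := by positivity
    nlinarith [sq_nonneg (x - p), mul_neg_of_pos_of_neg h4 h2]
  set s := Real.sqrt d with hs
  have hs2 : s ^ 2 = d := Real.sq_sqrt hdp.le
  have hs0 : s ≠ 0 := (Real.sqrt_pos.2 hdp).ne'
  have hQ'form : C ((n : ℝ) ^ 2) * derivative Q = 2 * (X - C p) := by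
    rw [← derivative_C_mul, hQform, sq, derivative_sub, derivative_mul]
    simp
    ring
  set G := F - C ((M + m) / 2) with hG
  have hG' : derivative G = D := by simp [hG, hD]
  obtain ⟨γ, hγ, hsol⟩ := aux_solve n hn G (hFM _).2 p s hs0 (by
    rw [hG', hs2, ← hQform]
    have h2G : 2 * G = 2 * F - C M - C m := by
      have : C M + C m = 2 * C ((M + m) / 2) := by
        rw [← C_add, ← C_ofNat, ← C_mul]; congr 1; ring
      rw [hG]; linear_combination this
    apply mul_left_cancel₀ (two_ne_zero : (2 : ℝ[X]) ≠ 0)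
    linear_combination C ((n : ℝ) ^ 2) * h2G + C ((n : ℝ) ^ 2) * hodeQ + D * hQ'form)
  refine ⟨s⁻¹, -(p * s⁻¹), γ, (M + m) / 2, inv_ne_zero hs0, hγ, fun x => ?_⟩
  rw [← hsol, hG]
  simp


/-- a monic real polynomial of degree `n ≥ 2` with `n` distinct real
roots takes the same value at all its local maximum points and the same value at
all its local minimum points if and only if it is a Chebyshev polynomial of the
first kind up to affine transformations of the domain and the image. -/
theorem statement18 (n : ℕ) (hn : 2 ≤ n) (F : Polynomial ℝ)
    (hmonic : F.Monic) (hdeg : F.natDegree = n) (hroots : F.roots.toFinset.card = n) :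
    ((∀ x y : ℝ, IsLocalMax (fun t => F.eval t) x → IsLocalMax (fun t => F.eval t) y →
        F.eval x = F.eval y) ∧
     (∀ x y : ℝ, IsLocalMin (fun t => F.eval t) x → IsLocalMin (fun t => F.eval t) y →
        F.eval x = F.eval y)) ↔
    (∃ α β γ δ : ℝ, α ≠ 0 ∧ γ ≠ 0 ∧
      ∀ x : ℝ, F.eval x = γ * (Polynomial.Chebyshev.T ℝ (n : ℤ)).eval (α * x + β) + δ) := by

  constructor
  · rintro ⟨hmax, hmin⟩
    exact aux_forward n hn F hmonic hdeg hroots hmax hmin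
  · rintro ⟨α, β, γ, δ, hα, hγ, hF⟩
    obtain ⟨h1, h2⟩ := aux_backward n hn F α β γ δ hα hγ hF
    exact ⟨fun x y hx hy => by rw [h1 x hx, h1 y hy], fun x y hx hy => by rw [h2 x hx, h2 y hy]⟩
end

section
/- Let n ≥ 3 and let F be a monic real polynomial of degree n with n distinct real roots. Then F has at least one local maximum point and at least one local minimum point, and, setting A = max{F(x) : x is a local minimum point of F} and B = min{F(x) : x is a local maximum point of F}, one has A < 0 < B and {s ∈ ℝ : the polynomial F − s has n real roots counted with multiplicity} = [A, B]. -/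
open Polynomial

open Topology Filter

/-- Laguerre inequality for products of linear factors. -/
lemma lag_prod (S : Multiset ℝ) (x : ℝ) :
    let P := (S.map (fun a => X - C a)).prod
    0 ≤ (P.derivative.eval x) ^ 2 - P.eval x * P.derivative.derivative.eval x ∧
    (S ≠ 0 → P.eval x ≠ 0 →
      0 < (P.derivative.eval x) ^ 2 - P.eval x * P.derivative.derivative.eval x) := by
  induction S using Multiset.induction_on with
  | empty => simp
  | cons a S ih =>
    simp only [Multiset.map_cons, Multiset.prod_cons] at ih ⊢
    set P := (S.map (fun a => X - C a)).prod with hP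
    have key : (eval x (derivative ((X - C a) * P))) ^ 2
        - eval x ((X - C a) * P) * eval x (derivative (derivative ((X - C a) * P)))
        = (P.eval x) ^ 2 + (x - a) ^ 2 *
          ((P.derivative.eval x) ^ 2 - P.eval x * P.derivative.derivative.eval x) := by
      simp only [derivative_mul, derivative_add, derivative_sub, derivative_X, derivative_C,
        eval_add, eval_mul, eval_sub, eval_X, eval_C, sub_zero, one_mul]
      ring
    rw [key]
    have h1 := mul_nonneg (sq_nonneg (x - a)) ih.1
    refine ⟨by positivity, fun _ h => ?_⟩
    have h2 : P.eval x ≠ 0 := fun h0 => h (by simp [h0])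
    have : 0 < (P.eval x) ^ 2 := by positivity
    linarith

lemma crit_neg (G : ℝ[X]) (hm : G.Monic) (hs : G.Splits) (hd : 0 < G.natDegree) (x : ℝ)
    (h0 : G.eval x ≠ 0) (h1 : G.derivative.eval x = 0) :
    G.eval x * G.derivative.derivative.eval x < 0 := by
  have e := hs.eq_prod_roots_of_monic hm
  have hne : G.roots ≠ 0 := by
    intro h
    have := hs.natDegree_eq_card_roots
    rw [h] at this
    simp at this
    omega
  have := (lag_prod G.roots x).2 hne
  rw [← e] at this
  have := this h0
  rw [h1] at this
  linarith

lemma deriv_ev (F : ℝ[X]) : deriv (fun t => F.eval t) = fun t => F.derivative.eval t := by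
  ext t; simp

lemma lmin_of (F : ℝ[X]) (x : ℝ) (h1 : F.derivative.eval x = 0)
    (h2 : 0 < F.derivative.derivative.eval x) : IsLocalMin (fun t => F.eval t) x := by
  apply isLocalMin_of_deriv_deriv_pos
  · rw [deriv_ev, deriv_ev]; exact h2
  · rw [deriv_ev]; exact h1
  · exact F.continuousAt

lemma lmax_of (F : ℝ[X]) (x : ℝ) (h1 : F.derivative.eval x = 0)
    (h2 : F.derivative.derivative.eval x < 0) : IsLocalMax (fun t => F.eval t) x := by
  have := (lmin_of (-F) x (by simpa using h1) (by simpa using h2)).neg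
  simpa using this

lemma lboth (F : ℝ[X]) (x : ℝ) (h1 : IsLocalMin (fun t => F.eval t) x)
    (h2 : IsLocalMax (fun t => F.eval t) x) : F.derivative.derivative.eval x = 0 := by
  have h : (fun t => F.eval t) =ᶠ[𝓝 x] fun _ => F.eval x := by
    filter_upwards [h1, h2] with t a b using le_antisymm b a
  have h' := h.deriv.deriv.eq_of_nhds
  rw [deriv_ev, deriv_ev] at h'
  simpa using h'

lemma crit_of_min (F : ℝ[X]) (x : ℝ) (h : IsLocalMin (fun t => F.eval t) x) :
    F.derivative.eval x = 0 ∧ 0 ≤ F.derivative.derivative.eval x := by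
  have h1 := h.deriv_eq_zero
  rw [deriv_ev] at h1
  refine ⟨h1, ?_⟩
  by_contra! hlt
  have := lboth F x h (lmax_of F x h1 hlt)
  linarith

lemma crit_of_max (F : ℝ[X]) (x : ℝ) (h : IsLocalMax (fun t => F.eval t) x) :
    F.derivative.eval x = 0 ∧ F.derivative.derivative.eval x ≤ 0 := by
  have h1 := h.deriv_eq_zero
  rw [deriv_ev] at h1
  refine ⟨h1, ?_⟩
  by_contra! hlt
  have := lboth F x (lmin_of F x h1 hlt) h
  linarith

lemma exists_lmax (f : ℝ → ℝ) (hf : Continuous f) (a b c : ℝ) (hab : a < b) (hbc : b < c)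
    (ha : f a = 0) (hb : f b = 0) (hc : f c = 0) : ∃ x, IsLocalMax f x := by
  obtain ⟨m, hm, hmax⟩ := isCompact_Icc.exists_isMaxOn (s := Set.Icc a c)
    ⟨b, hab.le, hbc.le⟩ hf.continuousOn
  by_cases h : 0 < f m
  · refine ⟨m, hmax.isLocalMax (Icc_mem_nhds ?_ ?_)⟩
    · exact lt_of_le_of_ne hm.1 (by rintro rfl; linarith)
    · exact lt_of_le_of_ne hm.2 (by rintro rfl; linarith)
  · refine ⟨b, ?_⟩
    filter_upwards [Icc_mem_nhds hab hbc] with y hy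
    have := hmax hy
    simp only [Set.mem_ofPred_eq] at this
    linarith

lemma three_sorted (s : Finset ℝ) (h : 3 ≤ s.card) :
    ∃ a ∈ s, ∃ b ∈ s, ∃ c ∈ s, a < b ∧ b < c := by
  let e := s.orderEmbOfFin rfl
  refine ⟨e ⟨0, by omega⟩, s.orderEmbOfFin_mem rfl _, e ⟨1, by omega⟩,
    s.orderEmbOfFin_mem rfl _, e ⟨2, by omega⟩, s.orderEmbOfFin_mem rfl _, ?_, ?_⟩ <;>
  · apply e.strictMono
    simp

lemma monic_sub (F : ℝ[X]) (hm : F.Monic) (hd : 0 < F.natDegree) (s : ℝ) :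
    (F - C s).Monic := by
  apply hm.sub_of_left
  apply lt_of_le_of_lt degree_C_le
  rwa [← natDegree_pos_iff_degree_pos]

/-- Lower bound for a split monic polynomial away from the real axis. -/
lemma im_bound (G : ℝ[X]) (hm : G.Monic) (hs : G.Splits) (z : ℂ) :
    |z.im| ^ G.natDegree ≤ ‖(G.map (algebraMap ℝ ℂ)).eval z‖ := by
  have e := hs.eq_prod_roots_of_monic hm
  have hc := hs.natDegree_eq_card_roots
  rw [hc]
  conv_rhs => rw [e]
  generalize G.roots = S
  induction S using Multiset.induction_on with
  | empty => simp
  | cons a S ih =>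
    simp only [Multiset.map_cons, Multiset.prod_cons, Multiset.card_cons, Polynomial.map_mul,
      eval_mul, norm_mul, pow_succ'] at ih ⊢
    refine mul_le_mul ?_ ih (by positivity) (norm_nonneg _)
    have := Complex.abs_im_le_norm (z - a)
    simpa using this

/-- The set of parameters with `F - s` split is closed. -/
lemma closed_split (F : ℝ[X]) (hm : F.Monic) (hd : 0 < F.natDegree) :
    IsClosed {s : ℝ | (F - C s).Splits} := by
  rw [← closure_subset_iff_isClosed]
  intro s hs
  refine Splits.of_splits_map (algebraMap ℝ ℂ) (IsAlgClosed.splits _) ?_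
  intro z hz
  have hz0 : (F.map (algebraMap ℝ ℂ)).eval z = s := by
    have := (mem_roots'.1 hz).2
    simp only [IsRoot.def, Polynomial.map_sub, eval_sub, Polynomial.map_C, eval_C] at this
    simpa using sub_eq_zero.1 this
  have him : z.im = 0 := by
    by_contra hne
    have hpos : 0 < |z.im| ^ F.natDegree := by positivity
    obtain ⟨t, ht, hdist⟩ := Metric.mem_closure_iff.1 hs _ hpos
    have hb := im_bound (F - C t) (monic_sub F hm hd t) ht z
    rw [natDegree_sub_C] at hb
    simp only [Polynomial.map_sub, eval_sub, Polynomial.map_C, eval_C, hz0] at hb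
    have : ‖(s : ℂ) - algebraMap ℝ ℂ t‖ = dist s t := by
      rw [Real.dist_eq, Complex.coe_algebraMap, ← Complex.ofReal_sub, Complex.norm_real,
        Real.norm_eq_abs]
    linarith
  exact ⟨z.re, by apply Complex.ext <;> simp [him]⟩

/-- The set of parameters with `n` distinct roots is open. -/
lemma open_distinct (F : ℝ[X]) (hd : 0 < F.natDegree) :
    IsOpen {s : ℝ | (F - C s).roots.toFinset.card = F.natDegree} := by
  rw [isOpen_iff_mem_nhds]
  intro s hs
  simp only [Set.mem_ofPred_eq] at hs
  have hne : ∀ t : ℝ, F - C t ≠ 0 := fun t h => by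
    have := natDegree_sub_C (p := F) (a := t)
    rw [h] at this; simp at this; omega
  set R := (F - C s).roots.toFinset with hR
  have hnodup : (F - C s).roots.Nodup := by
    rw [← Multiset.dedup_eq_self]
    refine Multiset.eq_of_le_of_card_le (Multiset.dedup_le _) ?_
    have h1 := card_roots' (F - C s)
    rw [natDegree_sub_C] at h1
    have h2 : (F - C s).roots.dedup.card = F.natDegree := hs
    omega
  have hder : ∀ r ∈ R, F.eval r = s ∧ F.derivative.eval r ≠ 0 := by
    intro r hr
    have hr' : r ∈ (F - C s).roots := by simpa [hR] using hr
    have hroot := (mem_roots'.1 hr').2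
    refine ⟨by simpa [sub_eq_zero] using hroot, fun h0 => ?_⟩
    have h1 : 1 < (F - C s).rootMultiplicity r :=
      (one_lt_rootMultiplicity_iff_isRoot (hne s)).2 ⟨hroot, by simpa using h0⟩
    have h2 := Multiset.nodup_iff_count_le_one.1 hnodup r
    rw [count_roots] at h2
    omega
  obtain ⟨U, hU, hdisj⟩ := R.finite_toSet.t2_separation
  have hmem : ∀ r ∈ R, (fun t => F.eval t) '' (U r) ∈ 𝓝 s := by
    intro r hr
    have := (F.hasStrictDerivAt r).map_nhds_eq (hder r hr).2
    rw [(hder r hr).1] at this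
    rw [← this]
    exact image_mem_map ((hU r).2.mem_nhds (hU r).1)
  have hall : ∀ᶠ t in 𝓝 s, ∀ r ∈ R, t ∈ (fun t => F.eval t) '' (U r) :=
    (Filter.eventually_all_finset R).2 hmem
  filter_upwards [hall] with t ht
  change (F - C t).roots.toFinset.card = F.natDegree
  choose! g hg using ht
  apply le_antisymm
  · have h1 := card_roots' (F - C t)
    rw [natDegree_sub_C] at h1
    exact (Multiset.toFinset_card_le _).trans h1
  · rw [← hs]
    apply Finset.card_le_card_of_injOn g
    · intro r hr
      have := (hg r hr).2
      simp only [Finset.mem_coe, Multiset.mem_toFinset, mem_roots', IsRoot.def, eval_sub, eval_C]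
      exact ⟨hne t, by simp only at this; linarith⟩
    · intro r hr r' hr' heq
      by_contra hrr
      have := hdisj hr hr' hrr
      exact Set.disjoint_left.1 this (hg r hr).1 (heq ▸ (hg r' hr').1)

theorem statement19 (n : ℕ) (hn : 3 ≤ n) (F : Polynomial ℝ)
    (hmonic : F.Monic) (hdeg : F.natDegree = n) (hroots : F.roots.toFinset.card = n) :
    (∃ x : ℝ, IsLocalMax (fun t => F.eval t) x) ∧
    (∃ x : ℝ, IsLocalMin (fun t => F.eval t) x) ∧
    sSup {y : ℝ | ∃ x : ℝ, IsLocalMin (fun t => F.eval t) x ∧ y = F.eval x} < 0 ∧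
    0 < sInf {y : ℝ | ∃ x : ℝ, IsLocalMax (fun t => F.eval t) x ∧ y = F.eval x} ∧
    {s : ℝ | ((F - C s).roots.card : ℕ) = n} =
      Set.Icc (sSup {y : ℝ | ∃ x : ℝ, IsLocalMin (fun t => F.eval t) x ∧ y = F.eval x})
        (sInf {y : ℝ | ∃ x : ℝ, IsLocalMax (fun t => F.eval t) x ∧ y = F.eval x}) := by
  subst hdeg
  have hd : 0 < F.natDegree := by omega
  have hF0 : F ≠ 0 := hmonic.ne_zero
  have hF'0 : F.derivative ≠ 0 := by
    intro h
    have := derivative_eq_zero.1 h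
    omega
  have hsplit_iff : ∀ s : ℝ, (F - C s).Splits ↔ (F - C s).roots.card = F.natDegree := by
    intro s
    rw [splits_iff_card_roots, natDegree_sub_C]
  have hdist_split : ∀ s : ℝ, (F - C s).roots.toFinset.card = F.natDegree →
      (F - C s).Splits := by
    intro s h
    rw [hsplit_iff]
    have h1 := card_roots' (F - C s)
    rw [natDegree_sub_C] at h1
    have h2 := Multiset.toFinset_card_le (F - C s).roots
    omega
  have hnodup_of : ∀ s : ℝ, (F - C s).Splits →
      (∀ x, F.derivative.eval x = 0 → F.eval x ≠ s) →
      (F - C s).roots.toFinset.card = F.natDegree := by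
    intro s h hx
    rw [← (hsplit_iff s).1 h]
    apply Multiset.toFinset_card_of_nodup
    rw [Multiset.nodup_iff_count_le_one]
    intro r
    rw [count_roots]
    by_contra! hlt
    have := (one_lt_rootMultiplicity_iff_isRoot (monic_sub F hmonic hd s).ne_zero).1 hlt
    refine hx r (by simpa using this.2) ?_
    simpa [sub_eq_zero] using this.1
  have hFs : F.Splits := by
    have := hdist_split 0 (by simpa using hroots)
    simpa using this
  have hnocrit : ∀ x, F.derivative.eval x = 0 → F.eval x ≠ 0 := by
    intro x h1 h0
    have hlt := (one_lt_rootMultiplicity_iff_isRoot hF0).2 ⟨h0, h1⟩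
    have hnd : F.roots.Nodup := by
      rw [← Multiset.dedup_eq_self]
      refine Multiset.eq_of_le_of_card_le (Multiset.dedup_le _) ?_
      have h1 := card_roots' F
      have h2 : F.roots.dedup.card = F.natDegree := hroots
      omega
    have h2 := Multiset.nodup_iff_count_le_one.1 hnd x
    rw [count_roots] at h2
    omega
  obtain ⟨a, ha, b, hb, c, hc, hab, hbc⟩ := three_sorted F.roots.toFinset (by omega)
  have hev : ∀ r ∈ F.roots.toFinset, F.eval r = 0 := by
    intro r hr
    exact (mem_roots'.1 (Multiset.mem_toFinset.1 hr)).2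
  have hmaxex : ∃ x : ℝ, IsLocalMax (fun t => F.eval t) x :=
    exists_lmax _ F.continuous a b c hab hbc (hev a ha) (hev b hb) (hev c hc)
  have hminex : ∃ x : ℝ, IsLocalMin (fun t => F.eval t) x := by
    obtain ⟨x, hx⟩ := exists_lmax (fun t => -F.eval t) F.continuous.neg a b c hab hbc
      (by simp [hev a ha]) (by simp [hev b hb]) (by simp [hev c hc])
    exact ⟨x, by simpa using hx.neg⟩
  -- values at extrema against split parameters
  have hmin_le : ∀ s : ℝ, (F - C s).Splits → ∀ x, IsLocalMin (fun t => F.eval t) x →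
      F.eval x ≤ s := by
    intro s hs x hx
    obtain ⟨h1, h2⟩ := crit_of_min F x hx
    by_contra! hlt
    have := crit_neg (F - C s) (monic_sub F hmonic hd s) hs (by rwa [natDegree_sub_C]) x
      (by simp; linarith) (by simpa using h1)
    simp at this
    nlinarith
  have hmax_ge : ∀ s : ℝ, (F - C s).Splits → ∀ x, IsLocalMax (fun t => F.eval t) x →
      s ≤ F.eval x := by
    intro s hs x hx
    obtain ⟨h1, h2⟩ := crit_of_max F x hx
    by_contra! hlt
    have := crit_neg (F - C s) (monic_sub F hmonic hd s) hs (by rwa [natDegree_sub_C]) x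
      (by simp; linarith) (by simpa using h1)
    simp at this
    nlinarith
  set MI := {y : ℝ | ∃ x : ℝ, IsLocalMin (fun t => F.eval t) x ∧ y = F.eval x} with hMI
  set MA := {y : ℝ | ∃ x : ℝ, IsLocalMax (fun t => F.eval t) x ∧ y = F.eval x} with hMA
  have hfin : ((fun t => F.eval t) '' {x | F.derivative.eval x = 0}).Finite := by
    apply Set.Finite.image
    apply F.derivative.roots.toFinset.finite_toSet.subset
    intro x hx
    simpa [hF'0] using hx
  have hMIfin : MI.Finite := hfin.subset (by
    rintro y ⟨x, hx, rfl⟩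
    exact ⟨x, (crit_of_min F x hx).1, rfl⟩)
  have hMAfin : MA.Finite := hfin.subset (by
    rintro y ⟨x, hx, rfl⟩
    exact ⟨x, (crit_of_max F x hx).1, rfl⟩)
  have hMIne : MI.Nonempty := by
    obtain ⟨x, hx⟩ := hminex
    exact ⟨_, x, hx, rfl⟩
  have hMAne : MA.Nonempty := by
    obtain ⟨x, hx⟩ := hmaxex
    exact ⟨_, x, hx, rfl⟩
  have hF0s : (F - C 0).Splits := by simpa using hFs
  have hA : sSup MI < 0 := by
    obtain ⟨x, hx, he⟩ := hMIne.csSup_mem hMIfin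
    rw [he]
    exact lt_of_le_of_ne (hmin_le 0 hF0s x hx) (hnocrit x (crit_of_min F x hx).1)
  have hB : 0 < sInf MA := by
    obtain ⟨x, hx, he⟩ := hMAne.csInf_mem hMAfin
    rw [he]
    exact lt_of_le_of_ne (hmax_ge 0 hF0s x hx) (hnocrit x (crit_of_max F x hx).1).symm
  refine ⟨hmaxex, hminex, hA, hB, ?_⟩
  have hcl : closure {s : ℝ | (F - C s).roots.toFinset.card = F.natDegree} ⊆
      {s : ℝ | (F - C s).Splits} :=
    closure_minimal (fun s hs => hdist_split s hs) (closed_split F hmonic hd)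
  have hIoo : Set.Ioo (sSup MI) (sInf MA) ⊆
      {s : ℝ | (F - C s).roots.toFinset.card = F.natDegree} := by
    apply isPreconnected_Ioo.subset_of_closure_inter_subset (open_distinct F hd)
    · exact ⟨0, ⟨hA, hB⟩, by simpa using hroots⟩
    · rintro s ⟨hs, hsA, hsB⟩
      refine hnodup_of s (hcl hs) ?_
      rintro x h1 rfl
      have h0 := hnocrit x h1
      have hneg := crit_neg F hmonic hFs hd x h0 h1
      rcases lt_or_gt_of_ne h0 with h | h
      · have := lmin_of F x h1 (by nlinarith)
        exact absurd (le_csSup hMIfin.bddAbove ⟨x, this, rfl⟩) (not_le.2 hsA)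
      · have := lmax_of F x h1 (by nlinarith)
        exact absurd (csInf_le hMAfin.bddBelow ⟨x, this, rfl⟩) (not_le.2 hsB)
  apply Set.Subset.antisymm
  · intro s hs
    have hs' : (F - C s).Splits := (hsplit_iff s).2 hs
    constructor
    · apply csSup_le hMIne
      rintro y ⟨x, hx, rfl⟩
      exact hmin_le s hs' x hx
    · apply le_csInf hMAne
      rintro y ⟨x, hx, rfl⟩
      exact hmax_ge s hs' x hx
  · intro s hs
    rw [← closure_Ioo (hA.trans hB).ne] at hs
    exact (hsplit_iff s).1 (hcl (closure_mono hIoo hs))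
end
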